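/- Let n ≥ 2, let A = Mat_{n×n}(ℂ), and let r(v;y₁,y₂) be a unitary solution of the AYBE of the form (*). Then for all pairwise distinct y₁,y₂,y₃ the Taylor coefficients satisfy r₁^{12}(y₁,y₂) + r₁^{13}(y₁,y₃) + r₁^{23}(y₂,y₃) = r₀^{12}(y₁,y₂)·r₀^{13}(y₁,y₃) − r₀^{23}(y₂,y₃)·r₀^{12}(y₁,y₂) + r₀^{13}(y₁,y₃)·r₀^{23}(y₂,y₃). -/

import Mathlib

open Matrix Kronecker Filter Topology Set

noncomputable section

attribute [local instance] Matrix.normedAddCommGroup Matrix.normedSpace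

abbrev Mat (n : ℕ) : Type := Matrix (Fin n) (Fin n) ℂ
abbrev T2 (n : ℕ) : Type := Matrix (Fin n × Fin n) (Fin n × Fin n) ℂ
abbrev T3 (n : ℕ) : Type := Matrix (Fin n × Fin n × Fin n) (Fin n × Fin n × Fin n) ℂ

/-- The embedding `t ↦ t^{12}` of `A ⊗ A` into `A ⊗ A ⊗ A`. -/
def emb12 {n : ℕ} (t : T2 n) : T3 n :=
  Matrix.of fun p q => t (p.1, p.2.1) (q.1, q.2.1) * (if p.2.2 = q.2.2 then 1 else 0)

/-- The embedding `t ↦ t^{13}` of `A ⊗ A` into `A ⊗ A ⊗ A`. -/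
def emb13 {n : ℕ} (t : T2 n) : T3 n :=
  Matrix.of fun p q => t (p.1, p.2.2) (q.1, q.2.2) * (if p.2.1 = q.2.1 then 1 else 0)

/-- The embedding `t ↦ t^{23}` of `A ⊗ A` into `A ⊗ A ⊗ A`. -/
def emb23 {n : ℕ} (t : T2 n) : T3 n :=
  Matrix.of fun p q => t (p.2.1, p.2.2) (q.2.1, q.2.2) * (if p.1 = q.1 then 1 else 0)

/-- The flip `t ↦ t^{21}` on `A ⊗ A`. -/
def tflip {n : ℕ} (t : T2 n) : T2 n :=
  Matrix.of fun p q => t (p.2, p.1) (q.2, q.1)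

/-- The associative Yang–Baxter equation with three spectral parameters. -/
def IsAYBESolution {n : ℕ} (r : ℂ → ℂ → ℂ → T2 n) : Prop :=
  ∀ u v y₁ y₂ y₃ : ℂ, u ≠ 0 → v ≠ 0 → u + v ≠ 0 → y₁ ≠ y₂ → y₁ ≠ y₃ → y₂ ≠ y₃ →
    emb12 (r u y₁ y₂) * emb23 (r (u + v) y₂ y₃) =
      emb13 (r (u + v) y₁ y₃) * emb12 (r (-v) y₁ y₂) + emb23 (r v y₂ y₃) * emb13 (r u y₁ y₃)

/-- Unitarity: `r^{21}(-v; y₂, y₁) = - r(v; y₁, y₂)`. -/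
def IsUnitarySolution {n : ℕ} (r : ℂ → ℂ → ℂ → T2 n) : Prop :=
  ∀ v y₁ y₂ : ℂ, v ≠ 0 → y₁ ≠ y₂ → tflip (r (-v) y₂ y₁) = - r v y₁ y₂

/-- `can : A ⊗ A → End(A)`, `X ⊗ Y ↦ (Z ↦ tr(XZ)·Y)`. -/
def canMap {n : ℕ} (t : T2 n) (Z : Mat n) : Mat n :=
  Matrix.of fun k l => ∑ i, ∑ j, t (i, k) (j, l) * Z j i

/-- Non-degeneracy: on a dense subset of the domain the tensor is invertible under `can`. -/
def IsNonDegenerate {n : ℕ} (r : ℂ → ℂ → ℂ → T2 n) : Prop :=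
  {p : ℂ × ℂ × ℂ | p.1 ≠ 0 ∧ p.2.1 ≠ p.2.2} ⊆
    closure {p : ℂ × ℂ × ℂ | p.1 ≠ 0 ∧ p.2.1 ≠ p.2.2 ∧
      Function.Bijective (canMap (r p.1 p.2.1 p.2.2))}

/-- `r` is holomorphic on `{(v,y₁,y₂) : v ≠ 0, y₁ ≠ y₂}`. -/
def IsHolomorphicOnDomain {n : ℕ} (r : ℂ → ℂ → ℂ → T2 n) : Prop :=
  DifferentiableOn ℂ (fun p : ℂ × ℂ × ℂ => r p.1 p.2.1 p.2.2)
    {p : ℂ × ℂ × ℂ | p.1 ≠ 0 ∧ p.2.1 ≠ p.2.2}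

/-- `r` is of the form (*): `r(v;y₁,y₂) = v⁻¹·1⊗1 + r₀(y₁,y₂) + v·r₁(y₁,y₂) + …`,
with Taylor coefficients `rc k`. -/
def HasLaurentForm {n : ℕ} (r : ℂ → ℂ → ℂ → T2 n) (rc : ℕ → ℂ → ℂ → T2 n) : Prop :=
  ∀ y₁ y₂ : ℂ, y₁ ≠ y₂ → ∃ ε > 0, ∀ v : ℂ, v ≠ 0 → ‖v‖ < ε →
    HasSum (fun k : ℕ => v ^ k • rc k y₁ y₂) (r v y₁ y₂ - v⁻¹ • 1)

/-- `r` is meromorphic along the diagonal. -/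
def IsMeromorphicAlongDiagonal {n : ℕ} (r : ℂ → ℂ → ℂ → T2 n) : Prop :=
  ∀ u : ℂ, u ≠ 0 → ∀ y₁ : ℂ, MeromorphicAt (fun y₂ => r u y₁ y₂) y₁

/-- `pr ⊗ id` on `A ⊗ A`, where `pr X = X - (tr X / n)·1`. -/
def prLeft {n : ℕ} (t : T2 n) : T2 n :=
  Matrix.of fun p q => t p q - if p.1 = q.1 then (∑ m, t (m, p.2) (m, q.2)) / (n : ℂ) else 0

/-- `id ⊗ pr` on `A ⊗ A`. -/
def prRight {n : ℕ} (t : T2 n) : T2 n :=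
  Matrix.of fun p q => t p q - if p.2 = q.2 then (∑ m, t (p.1, m) (q.1, m)) / (n : ℂ) else 0

/-- `pr ⊗ pr` on `A ⊗ A`. -/
def prTensorPr {n : ℕ} (t : T2 n) : T2 n := prLeft (prRight t)

/-- `c` has no infinitesimal symmetries: the only traceless `a` with
`[c(y₁,y₂), a⊗1 + 1⊗a] = 0` for all `y₁ ≠ y₂` is `a = 0`. -/
def HasNoInfinitesimalSymmetry {n : ℕ} (c : ℂ → ℂ → T2 n) : Prop :=
  ∀ a : Mat n, a.trace = 0 →
    (∀ y₁ y₂ : ℂ, y₁ ≠ y₂ →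
      c y₁ y₂ * (a ⊗ₖ (1 : Mat n) + (1 : Mat n) ⊗ₖ a) =
        (a ⊗ₖ (1 : Mat n) + (1 : Mat n) ⊗ₖ a) * c y₁ y₂) → a = 0

/-- The quantum Yang–Baxter equation. -/
def SatisfiesQYBE {n : ℕ} (q : ℂ → ℂ → T2 n) : Prop :=
  ∀ y₁ y₂ y₃ : ℂ, y₁ ≠ y₂ → y₁ ≠ y₃ → y₂ ≠ y₃ →
    emb12 (q y₁ y₂) * emb13 (q y₁ y₃) * emb23 (q y₂ y₃) =
      emb23 (q y₂ y₃) * emb13 (q y₁ y₃) * emb12 (q y₁ y₂)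

/-- The permutation tensor `P = Σ e_{ij} ⊗ e_{ji}`. -/
def Pmat (n : ℕ) : T2 n :=
  ∑ i : Fin n, ∑ j : Fin n,
    Matrix.single i j (1 : ℂ) ⊗ₖ Matrix.single j i (1 : ℂ)

/-- The reversal of the three tensor positions. -/
def rev3 (n : ℕ) : (Fin n × Fin n × Fin n) ≃ (Fin n × Fin n × Fin n) where
  toFun p := (p.2.2, p.2.1, p.1)
  invFun p := (p.2.2, p.2.1, p.1)
  left_inv _ := rfl
  right_inv _ := rfl

def emb12L (n : ℕ) : T2 n →ₗ[ℂ] T3 n where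
  toFun := emb12
  map_add' s t := by ext p q; simp only [emb12, Matrix.of_apply, Matrix.add_apply, add_mul]
  map_smul' c t := by ext p q; simp [emb12]

def emb13L (n : ℕ) : T2 n →ₗ[ℂ] T3 n where
  toFun := emb13
  map_add' s t := by ext p q; simp only [emb13, Matrix.of_apply, Matrix.add_apply, add_mul]
  map_smul' c t := by ext p q; simp [emb13]

def emb23L (n : ℕ) : T2 n →ₗ[ℂ] T3 n where
  toFun := emb23
  map_add' s t := by ext p q; simp only [emb23, Matrix.of_apply, Matrix.add_apply, add_mul]
  map_smul' c t := by ext p q; simp [emb23]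

lemma emb12L_one (n : ℕ) : emb12L n 1 = 1 := by
  ext ⟨a, b, c⟩ ⟨d, e, f⟩
  simp only [emb12L, emb12, LinearMap.coe_mk, AddHom.coe_mk, Matrix.of_apply, Matrix.one_apply,
    Prod.mk.injEq]
  split_ifs <;> simp_all

lemma emb13L_one (n : ℕ) : emb13L n 1 = 1 := by
  ext ⟨a, b, c⟩ ⟨d, e, f⟩
  simp only [emb13L, emb13, LinearMap.coe_mk, AddHom.coe_mk, Matrix.of_apply, Matrix.one_apply,
    Prod.mk.injEq]
  split_ifs <;> simp_all

lemma emb23L_one (n : ℕ) : emb23L n 1 = 1 := by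
  ext ⟨a, b, c⟩ ⟨d, e, f⟩
  simp only [emb23L, emb23, LinearMap.coe_mk, AddHom.coe_mk, Matrix.of_apply, Matrix.one_apply,
    Prod.mk.injEq]
  split_ifs <;> simp_all

lemma rev_emb12 {n : ℕ} (t : T2 n) :
    (emb12 t).submatrix (rev3 n) (rev3 n) = emb23L n (tflip t) := by
  ext p q; rfl

lemma rev_emb13 {n : ℕ} (t : T2 n) :
    (emb13 t).submatrix (rev3 n) (rev3 n) = emb13L n (tflip t) := by
  ext p q; rfl

lemma rev_emb23 {n : ℕ} (t : T2 n) :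
    (emb23 t).submatrix (rev3 n) (rev3 n) = emb12L n (tflip t) := by
  ext p q; rfl

/-- The AYBE in reversed form. -/
lemma aybe_rev {n : ℕ} (r : ℂ → ℂ → ℂ → T2 n)
    (hAYBE : IsAYBESolution r) (hUnit : IsUnitarySolution r)
    (u v y₁ y₂ y₃ : ℂ) (hu : u ≠ 0) (hv : v ≠ 0) (huv : u + v ≠ 0)
    (h12 : y₁ ≠ y₂) (h13 : y₁ ≠ y₃) (h23 : y₂ ≠ y₃) :
    emb23L n (r u y₂ y₃) * emb12L n (r (u + v) y₁ y₂) =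
      emb13L n (r (u + v) y₁ y₃) * emb23L n (r (-v) y₂ y₃) +
        emb12L n (r v y₁ y₂) * emb13L n (r u y₁ y₃) := by
  have h := hAYBE (-u) (-v) y₃ y₂ y₁ (neg_ne_zero.2 hu) (neg_ne_zero.2 hv)
    (by rw [← neg_add]; exact neg_ne_zero.2 huv) h23.symm h13.symm h12.symm
  have h' := congrArg (fun M : T3 n => M.submatrix (rev3 n) (rev3 n)) h
  simp only [Matrix.submatrix_add, Pi.add_apply, ← neg_add] at h'
  rw [← Matrix.submatrix_mul_equiv _ _ _ (rev3 n) _, ← Matrix.submatrix_mul_equiv _ _ _ (rev3 n) _,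
    ← Matrix.submatrix_mul_equiv _ _ _ (rev3 n) _] at h'
  simp only [rev_emb12, rev_emb13, rev_emb23] at h'
  have e := hUnit (-v) y₂ y₃ (neg_ne_zero.2 hv) h23
  rw [hUnit u y₂ y₃ hu h23, hUnit (u + v) y₁ y₂ huv h12, hUnit (u + v) y₁ y₃ huv h13,
    hUnit v y₁ y₂ hv h12, hUnit u y₁ y₃ hu h13, e] at h'
  simpa only [map_neg, neg_mul_neg] using h'

/-- A convergent power series has the expected difference quotient at `0`. -/
lemma series_slope {E : Type} [NormedAddCommGroup E] [NormedSpace ℂ E]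
    (c : ℕ → E) (F : ℂ → E) (ε : ℝ) (hε : 0 < ε) (hF0 : F 0 = c 0)
    (H : ∀ v : ℂ, v ≠ 0 → ‖v‖ < ε → HasSum (fun k : ℕ => v ^ k • c k) (F v)) :
    Tendsto (fun u : ℂ => u⁻¹ • (F u - F 0)) (𝓝[≠] 0) (𝓝 (c 1)) := by
  let p : FormalMultilinearSeries ℂ ℂ E :=
    fun k => ContinuousMultilinearMap.mkPiRing ℂ (Fin k) (c k)
  have hc : ∀ k, p.coeff k = c k := by
    intro k
    simp [p, FormalMultilinearSeries.coeff]
  have hp : HasFPowerSeriesAt F p 0 := by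
    rw [hasFPowerSeriesAt_iff]
    filter_upwards [Metric.ball_mem_nhds (0 : ℂ) hε] with v hv
    simp only [hc, zero_add]
    by_cases hv0 : v = 0
    · subst hv0
      rw [hF0]
      convert hasSum_single (f := fun k : ℕ => (0 : ℂ) ^ k • c k) 0 ?_ using 1
      · simp
      · intro k hk
        simp [hk]
    · exact H v hv0 (by simpa using hv)
  have h := hp.hasDerivAt
  change HasDerivAt F (p.coeff 1) 0 at h
  rw [hc] at h
  have h2 := h.tendsto_slope
  refine h2.congr fun u => ?_
  simp [slope]

/-- The regular part of `r` at `v = 0`. -/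
lemma exists_regular {n : ℕ} (r : ℂ → ℂ → ℂ → T2 n) (rc : ℕ → ℂ → ℂ → T2 n)
    (hForm : HasLaurentForm r rc) (y₁ y₂ : ℂ) (h : y₁ ≠ y₂) :
    ∃ F : ℂ → T2 n, F 0 = rc 0 y₁ y₂ ∧
      Tendsto (fun u : ℂ => u⁻¹ • (F u - F 0)) (𝓝[≠] 0) (𝓝 (rc 1 y₁ y₂)) ∧
      ∀ v, v ≠ 0 → r v y₁ y₂ = v⁻¹ • 1 + F v := by
  obtain ⟨ε, hε, H⟩ := hForm y₁ y₂ h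
  let F : ℂ → T2 n := fun v => if v = 0 then rc 0 y₁ y₂ else r v y₁ y₂ - v⁻¹ • 1
  have hF0 : F 0 = rc 0 y₁ y₂ := by simp [F]
  have hF : ∀ v, v ≠ 0 → F v = r v y₁ y₂ - v⁻¹ • 1 := fun v hv => by simp [F, hv]
  refine ⟨F, hF0, ?_, ?_⟩
  · exact series_slope (fun k => rc k y₁ y₂) F ε hε hF0 (fun v hv hv' => by
      rw [hF v hv]; exact H v hv hv')
  · intro v hv
    rw [hF v hv]; abel

lemma emb_slope {n : ℕ} (L : T2 n →ₗ[ℂ] T3 n) (F : ℂ → T2 n) (F' : T2 n)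
    (h : Tendsto (fun u : ℂ => u⁻¹ • (F u - F 0)) (𝓝[≠] 0) (𝓝 F')) :
    Tendsto (fun u : ℂ => u⁻¹ • (L (F u) - L (F 0))) (𝓝[≠] 0) (𝓝 (L F')) := by
  have hL : Continuous L := L.continuous_of_finiteDimensional
  refine ((hL.tendsto F').comp h).congr fun u => ?_
  simp only [Function.comp, map_smul, map_sub]

lemma tendsto_mul_punctured (c : ℂ) (hc : c ≠ 0) :
    Tendsto (fun u : ℂ => c * u) (𝓝[≠] 0) (𝓝[≠] 0) := by
  refine tendsto_nhdsWithin_iff.2 ⟨?_, ?_⟩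
  · have : Continuous fun u : ℂ => c * u := by fun_prop
    simpa using (this.tendsto 0).mono_left (nhdsWithin_le_nhds (s := {0}ᶜ))
  · filter_upwards [self_mem_nhdsWithin] with u hu
    exact mul_ne_zero hc hu

section
variable {E : Type} [Ring E] [Algebra ℂ E] [TopologicalSpace E] [T2Space E]
  [IsTopologicalRing E] [ContinuousSMul ℂ E]

lemma cont_of_slope (A : ℂ → E) (A' : E)
    (hA : Tendsto (fun u : ℂ => u⁻¹ • (A u - A 0)) (𝓝[≠] 0) (𝓝 A')) :
    Tendsto A (𝓝[≠] 0) (𝓝 (A 0)) := by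
  have hid : Tendsto (fun u : ℂ => u) (𝓝[≠] 0) (𝓝 0) := nhdsWithin_le_nhds
  have h := (hid.smul hA).add_const (A 0)
  simp only [zero_smul, zero_add] at h
  refine h.congr' ?_
  filter_upwards [self_mem_nhdsWithin] with u hu
  have hu : u ≠ 0 := hu
  rw [smul_inv_smul₀ hu]
  abel

/-- The limiting argument. -/
lemma limit_step (A B C : ℂ → E) (A' B' C' : E)
    (hA : Tendsto (fun u : ℂ => u⁻¹ • (A u - A 0)) (𝓝[≠] 0) (𝓝 A'))
    (hB : Tendsto (fun u : ℂ => u⁻¹ • (B u - B 0)) (𝓝[≠] 0) (𝓝 B'))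
    (hC : Tendsto (fun u : ℂ => u⁻¹ • (C u - C 0)) (𝓝[≠] 0) (𝓝 C'))
    (H : ∀ u : ℂ, u ≠ 0 →
      (u⁻¹ • 1 + C u) * ((2 * u)⁻¹ • 1 + A (2 * u)) =
        ((2 * u)⁻¹ • 1 + B (2 * u)) * ((-u)⁻¹ • 1 + C (-u)) +
          (u⁻¹ • 1 + A u) * (u⁻¹ • 1 + B u)) :
    A' + B' + C' = A 0 * B 0 - C 0 * A 0 + B 0 * C 0 := by
  have two := tendsto_mul_punctured 2 two_ne_zero
  have ng := tendsto_mul_punctured (-1) (by norm_num)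
  have cA := cont_of_slope A A' hA
  have cB := cont_of_slope B B' hB
  have cC := cont_of_slope C C' hC
  have lim1 := ((((hA.comp two).const_smul (2 : ℂ)).sub hA).add
    (((hB.comp two).const_smul (2 : ℂ)).sub hB)).add
    ((hC.add (hC.comp ng)).const_smul (2⁻¹ : ℂ))
  have lim2 := ((cA.mul cB).sub (cC.mul (cA.comp two))).add ((cB.comp two).mul (cC.comp ng))
  have key := tendsto_nhds_unique (lim1.congr' (by
    filter_upwards [self_mem_nhdsWithin] with u hu
    have hu : u ≠ 0 := hu
    have h := H u hu
    simp only [Function.comp, neg_one_mul]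
    rw [mul_inv, inv_neg] at *
    generalize u⁻¹ = w at *
    simp only [add_mul, mul_add, smul_mul_assoc, mul_smul_comm, one_mul, mul_one] at h
    linear_combination (norm := module) h)) lim2
  rw [← key]
  module

end

/-- For a unitary solution of the AYBE of the form (*), the Taylor
coefficients satisfy `r₁^{12} + r₁^{13} + r₁^{23} = r₀^{12}r₀^{13} − r₀^{23}r₀^{12} + r₀^{13}r₀^{23}`. -/
theorem r_one_determined_by_r_zero (n : ℕ) (hn : 2 ≤ n)
    (r : ℂ → ℂ → ℂ → T2 n) (rc : ℕ → ℂ → ℂ → T2 n)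
    (hAYBE : IsAYBESolution r) (hUnit : IsUnitarySolution r) (hForm : HasLaurentForm r rc) :
    ∀ y₁ y₂ y₃ : ℂ, y₁ ≠ y₂ → y₁ ≠ y₃ → y₂ ≠ y₃ →
      emb12 (rc 1 y₁ y₂) + emb13 (rc 1 y₁ y₃) + emb23 (rc 1 y₂ y₃) =
        emb12 (rc 0 y₁ y₂) * emb13 (rc 0 y₁ y₃) - emb23 (rc 0 y₂ y₃) * emb12 (rc 0 y₁ y₂) +
          emb13 (rc 0 y₁ y₃) * emb23 (rc 0 y₂ y₃) := by
  intro y₁ y₂ y₃ h12 h13 h23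
  obtain ⟨A, hA0, hA, hAr⟩ := exists_regular r rc hForm y₁ y₂ h12
  obtain ⟨B, hB0, hB, hBr⟩ := exists_regular r rc hForm y₁ y₃ h13
  obtain ⟨C, hC0, hC, hCr⟩ := exists_regular r rc hForm y₂ y₃ h23
  have key := limit_step _ _ _ _ _ _ (emb_slope (emb12L n) A _ hA) (emb_slope (emb13L n) B _ hB)
    (emb_slope (emb23L n) C _ hC) (by
    intro u hu
    have h2u : u + u ≠ 0 := by rw [← two_mul]; exact mul_ne_zero two_ne_zero hu
    have h := aybe_rev r hAYBE hUnit u u y₁ y₂ y₃ hu hu h2u h12 h13 h23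
    rw [hAr _ h2u, hAr _ hu, hBr _ h2u, hBr _ hu, hCr _ hu, hCr _ (neg_ne_zero.2 hu)] at h
    simpa only [map_add, map_smul, emb12L_one, emb13L_one, emb23L_one, ← two_mul] using h)
  rw [hA0, hB0, hC0] at key
  exact key
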